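/- arXiv:1405.2937 — 2 statements merged into one kernel-verified Lean document; each statement's English description precedes it below -/
import Mathlib

section
/- Let $A$ be a ring, and let $f: A^m \to A^n$ and $f': A^{m'} \to A^{n'}$ be two maps of finite free modules over $A$. Suppose that for every ideal $I \subseteq A$, the kernels of the induced maps $(A/I)^m \to (A/I)^n$ and $(A/I)^{m'} \to (A/I)^{n'}$ are isomorphic as $A/I$-modules. Then for each $k \geq 0$, the ideal generated by the $(m+1-k) \times (m+1-k)$ minors of $f$ equals the ideal generated by the $(m'+1-k) \times (m'+1-k)$ minors of $f'$. (Here minors of size larger than the matrix, or of size $\leq 0$, generate the unit ideal and zero ideal by convention as appropriate.) -/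
/-- The ideal generated by all `s × s` minors of a matrix.  For `s = 0` the empty
determinant is `1`, giving the unit ideal; if `s` exceeds the number of rows or
columns, all such (degenerate) minors vanish, giving the zero ideal. -/
def minorsIdeal {A : Type*} [CommRing A] {n m : ℕ}
    (M : Matrix (Fin n) (Fin m) A) (s : ℕ) : Ideal A :=
  Ideal.span { x | ∃ (ri : Fin s → Fin n) (ci : Fin s → Fin m),
    Function.Injective ri ∧ Function.Injective ci ∧ x = (M.submatrix ri ci).det }

open Matrix

/-- All `s × s` minors of `A` vanish, possibly with repeated rows or columns. -/
def MinorsVanish {R ι κ : Type*} [CommRing R] (A : Matrix ι κ R) (s : ℕ) : Prop :=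
  ∀ (ri : Fin s → ι) (ci : Fin s → κ), (A.submatrix ri ci).det = 0

namespace MinorsVanish

variable {R ι κ : Type*} [CommRing R] {A : Matrix ι κ R} {s : ℕ}

theorem add_vecMulVec (h : MinorsVanish A s) (c : ι → R) (d : κ → R) :
    MinorsVanish (A + vecMulVec c d) (s + 1) := by
  classical
  intro ri ci
  let X : Fin (s + 1) → Fin (s + 1) → R := fun i j => c (ri i) * d (ci j)
  let Y : Fin (s + 1) → Fin (s + 1) → R := fun i j => A (ri i) (ci j)
  have hlhs : (A + vecMulVec c d).submatrix ri ci = of (X + Y) := by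
    ext i j
    simp [vecMulVec_apply, add_comm, X, Y]
  rw [hlhs]
  refine ((detRowAlternating (R := R) (n := Fin (s + 1))).toMultilinearMap.map_add_univ
    X Y).trans (Finset.sum_eq_zero fun S _ => ?_)
  change Matrix.det (of (S.piecewise X Y)) = 0
  by_cases hS : ∃ i, ∀ i' ∈ S, i' = i
  · obtain ⟨i, hi⟩ := hS
    rw [det_succ_row _ i]
    refine Finset.sum_eq_zero fun j _ => ?_
    have : (of (S.piecewise X Y)).submatrix i.succAbove j.succAbove =
        A.submatrix (ri ∘ i.succAbove) (ci ∘ j.succAbove) := by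
      ext a b
      have : i.succAbove a ∉ S := fun hmem => Fin.succAbove_ne i a (hi _ hmem)
      simp [this, Y]
    rw [this, h, mul_zero]
  · push Not at hS
    obtain ⟨i, hi, -⟩ := hS 0
    obtain ⟨i', hi', hne⟩ := hS i
    set N := of (S.piecewise X Y) with hN
    have h1 : N = updateRow N i (c (ri i) • fun j => d (ci j)) := by
      ext a b
      by_cases ha : a = i
      · subst ha
        rw [updateRow_self]
        simp [hN, hi, X]
      · simp [updateRow_ne ha]
    rw [h1, det_updateRow_smul]
    set N₁ := updateRow N i fun j => d (ci j) with hN₁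
    have h2 : N₁ = updateRow N₁ i' (c (ri i') • fun j => d (ci j)) := by
      ext a b
      by_cases ha : a = i'
      · subst ha
        rw [updateRow_self, hN₁, updateRow_ne hne]
        simp [hN, hi', X]
      · simp [updateRow_ne ha]
    rw [h2, det_updateRow_smul, det_zero_of_row_eq (i := i) (j := i') hne.symm, mul_zero, mul_zero]
    ext b
    rw [updateRow_self, updateRow_ne hne.symm, hN₁, updateRow_self]

theorem mono (h : MinorsVanish A s) {t : ℕ} (hst : s ≤ t) : MinorsVanish A t := by
  induction t, hst using Nat.le_induction with
  | base => exact h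
  | succ t _ ih => simpa using ih.add_vecMulVec 0 0

theorem add_mul {τ : Type*} [Fintype τ] (h : MinorsVanish A s) (C : Matrix ι τ R)
    (D : Matrix τ κ R) : MinorsVanish (A + C * D) (s + Fintype.card τ) := by
  classical
  have key : ∀ S : Finset τ, MinorsVanish
      (A + ∑ p ∈ S, vecMulVec (C.col p) (D.row p)) (s + S.card) := by
    intro S
    induction S using Finset.induction_on with
    | empty => simpa using h
    | insert p S hp ih =>
      rw [Finset.sum_insert hp, Finset.card_insert_of_notMem hp, 
        add_comm (vecMulVec _ _), ← add_assoc, ← add_assoc]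
      exact ih.add_vecMulVec _ _
  have hCD : C * D = ∑ p, vecMulVec (C.col p) (D.row p) := by
    ext i j
    simp [mul_apply, Matrix.sum_apply, vecMulVec_apply]
  rw [hCD]
  exact key Finset.univ

theorem mul_left {τ : Type*} [Fintype ι] (h : MinorsVanish A s) (C : Matrix τ ι R) :
    MinorsVanish (C * A) s := by
  classical
  intro ri ci
  have hrow : (C * A).submatrix ri ci =
      (fun i => ∑ p, C (ri i) p • fun j => A p (ci j) : Matrix (Fin s) (Fin s) R) := by
    ext i j
    simp [mul_apply]
  rw [hrow]
  refine ((detRowAlternating (R := R) (n := Fin s)).toMultilinearMap.map_sum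
    (fun i p => C (ri i) p • fun j => A p (ci j))).trans (Finset.sum_eq_zero fun q _ => ?_)
  rw [MultilinearMap.map_smul_univ]
  exact (congrArg _ (h q ci)).trans (smul_zero _)

theorem transpose (h : MinorsVanish A s) : MinorsVanish Aᵀ s := fun ri ci => by
  rw [← transpose_submatrix, det_transpose, h]

theorem mul_right {τ : Type*} [Fintype κ] (h : MinorsVanish A s) (D : Matrix κ τ R) :
    MinorsVanish (A * D) s := by
  simpa [transpose_mul] using (h.transpose.mul_left Dᵀ).transpose

theorem det_eq_zero [Fintype ι] [DecidableEq ι] {A : Matrix ι ι R} (h : MinorsVanish A s)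
    (hs : s ≤ Fintype.card ι) : A.det = 0 := by
  rw [← det_submatrix_equiv_self (Fintype.equivFin ι).symm]
  exact h.mono hs _ _

end MinorsVanish

section Socle

variable {B : Type*} [CommRing B] {x : B}

/-- If a nonzero `x` lies in every nonzero ideal, then its annihilator is nilpotent and every
element outside the annihilator is invertible. -/
theorem isNilpotent_torsionOf_and_exists_mul_eq_one [IsNoetherianRing B]
    (hx : ∀ y : B, y ≠ 0 → ∃ t, t * y = x) (hx0 : x ≠ 0) :
    IsNilpotent (Ideal.torsionOf B B x) ∧ ∀ t : B, t * x ≠ 0 → ∃ s, s * t = 1 := by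
  have hnil : ∀ t : B, t * x = 0 → IsNilpotent t := by
    intro t ht
    obtain ⟨n, hn⟩ := monotone_stabilizes_iff_noetherian.mpr (inferInstance : IsNoetherian B B)
      ⟨fun n => Ideal.torsionOf B B (t ^ n), fun a b hab y hy => by
        simp only [Ideal.mem_torsionOf_iff, smul_eq_mul] at hy ⊢
        rw [← Nat.sub_add_cancel hab, pow_add, mul_left_comm, hy, mul_zero]⟩
    refine ⟨n, by_contra fun hne => hx0 ?_⟩
    obtain ⟨u, hu⟩ := hx _ hne
    have h1 : u ∈ Ideal.torsionOf B B (t ^ (n + 1)) := by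
      simp only [Ideal.mem_torsionOf_iff, smul_eq_mul]
      rw [pow_succ, ← mul_assoc, hu, mul_comm, ht]
    have h2 := hn (n + 1) (Nat.le_succ n)
    change Ideal.torsionOf B B (t ^ n) = Ideal.torsionOf B B (t ^ (n + 1)) at h2
    rw [← h2] at h1
    simpa [Ideal.mem_torsionOf_iff, hu] using h1
  constructor
  · rw [Ideal.FG.isNilpotent_iff_le_nilradical (IsNoetherian.noetherian _)]
    intro t ht
    exact hnil t (by simpa [Ideal.mem_torsionOf_iff] using ht)
  · intro t ht
    obtain ⟨s, hs⟩ := hx _ ht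
    have h1 : IsNilpotent (1 - s * t) := hnil _ (by rw [sub_mul, mul_assoc, hs]; ring)
    have h2 : IsUnit (s * t) := by simpa using h1.isUnit_one_sub
    obtain ⟨u, hu⟩ := h2.exists_left_inv
    exact ⟨u * s, by rw [mul_assoc, hu]⟩

theorem exists_mem_notMem_of_isNilpotent {m I J : Ideal B} (hm : IsNilpotent m)
    (hIJ : ¬ I ≤ J) : ∃ a ∈ I, a ∉ J ∧ ∀ t ∈ m, t * a ∈ J := by
  obtain ⟨n, hn⟩ := hm
  have hle : m ^ n * I ≤ J := by
    rw [hn, Ideal.zero_eq_bot, Ideal.bot_mul]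
    exact bot_le
  clear hn
  induction n with
  | zero => exact absurd (by simpa using hle) hIJ
  | succ n ih =>
    by_cases h : m ^ n * I ≤ J
    · exact ih h
    · obtain ⟨a, ha, haJ⟩ := SetLike.not_le_iff_exists.mp h
      refine ⟨a, Ideal.mul_le_right ha, haJ, fun t ht => hle ?_⟩
      rw [pow_succ', mul_assoc]
      exact Ideal.mul_mem_mul ht ha

/-- If a nonzero `x` lies in every nonzero ideal, then every ideal contains (hence equals) its double
annihilator. -/
theorem mem_of_forall_annihilator [IsNoetherianRing B]
    (hx : ∀ y : B, y ≠ 0 → ∃ t, t * y = x) (hx0 : x ≠ 0) (I : Ideal B) :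
    ∀ z : B, (∀ c, (∀ a ∈ I, c * a = 0) → c * z = 0) → z ∈ I := by
  obtain ⟨hnil, hunit⟩ := isNilpotent_torsionOf_and_exists_mul_eq_one hx hx0
  obtain ⟨J, ⟨hJI, hJ⟩, hmax⟩ := set_has_maximal_iff_noetherian.mpr
    (inferInstance : IsNoetherian B B)
    {J : Ideal B | J ≤ I ∧ ∀ z : B, (∀ c, (∀ a ∈ J, c * a = 0) → c * z = 0) → z ∈ J}
    ⟨⊥, bot_le, fun z hz => by simpa using hz 1 (by simp)⟩
  by_cases hIJ : I ≤ J
  · rwa [le_antisymm hIJ hJI]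
  exfalso
  obtain ⟨a, haI, haJ, hma⟩ := exists_mem_notMem_of_isNilpotent hnil hIJ
  have hsoc : ∀ y : B, (∀ t, t * x = 0 → t * y = 0) → ∃ u, y = u * x := by
    intro y hy
    by_cases hy0 : y = 0
    · exact ⟨0, by simp [hy0]⟩
    obtain ⟨t, ht⟩ := hx y hy0
    obtain ⟨s, hs⟩ := hunit t fun h => hx0 (by rw [← ht, hy t h])
    exact ⟨s, by rw [← ht, ← mul_assoc, hs, one_mul]⟩
  have hma' : ∀ t, t * x = 0 → t * a ∈ J := fun t ht =>
    hma t (by simpa [Ideal.mem_torsionOf_iff] using ht)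
  obtain ⟨c₀, hc₀, hc₀a⟩ : ∃ c, (∀ b ∈ J, c * b = 0) ∧ c * a = x := by
    have : ¬ ∀ c, (∀ b ∈ J, c * b = 0) → c * a = 0 := fun h => haJ (hJ a h)
    push Not at this
    obtain ⟨c, hc, hca⟩ := this
    obtain ⟨t, ht⟩ := hx _ hca
    exact ⟨t * c, fun b hb => by rw [mul_assoc, hc b hb, mul_zero], by rw [mul_assoc, ht]⟩
  refine hmax (J ⊔ Ideal.span {a}) ⟨sup_le hJI (by simpa [Ideal.span_le] using haI), ?_⟩
    (lt_of_le_of_ne le_sup_left fun h =>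
      haJ (h ▸ Ideal.mem_sup_right (Ideal.mem_span_singleton_self a)))
  intro z hz
  have hz' : ∀ c, (∀ b ∈ J, c * b = 0) → c * a = 0 → c * z = 0 := by
    intro c hc hca
    refine hz c fun b hb => ?_
    obtain ⟨j, hj, k, hk, rfl⟩ := Submodule.mem_sup.mp hb
    obtain ⟨r, rfl⟩ := Ideal.mem_span_singleton'.mp hk
    rw [mul_add, hc j hj, mul_left_comm, hca, mul_zero, add_zero]
  obtain ⟨w, hw⟩ := hsoc (c₀ * z) fun t ht => by
    rw [← mul_assoc]
    exact hz' _ (fun b hb => by rw [mul_assoc, hc₀ b hb, mul_zero]) (by rw [mul_assoc, hc₀a, ht])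
  have hmem : z - w * a ∈ J := by
    refine hJ _ fun c hc => ?_
    obtain ⟨u, hu⟩ := hsoc (c * a) fun t ht => by
      rw [mul_left_comm]
      exact hc _ (hma' t ht)
    have := hz' (c - u * c₀) (fun b hb => by rw [sub_mul, hc b hb, mul_assoc, hc₀ b hb]; simp)
      (by rw [sub_mul, mul_assoc, hc₀a, hu, sub_self])
    linear_combination this + u * hw - w * hu
  have := Ideal.add_mem (J ⊔ Ideal.span {a}) (Ideal.mem_sup_left hmem)
    (Ideal.mem_sup_right (Ideal.mul_mem_left _ w (Ideal.mem_span_singleton_self a)))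
  simpa using this

/-- A Noetherian ring with a nonzero element lying in every nonzero ideal is self-injective. -/
theorem baer_of_forall_exists_mul_eq [IsNoetherianRing B]
    (hx : ∀ y : B, y ≠ 0 → ∃ t, t * y = x) (hx0 : x ≠ 0) : Module.Baer B B := by
  obtain ⟨hnil, hunit⟩ := isNilpotent_torsionOf_and_exists_mul_eq_one hx hx0
  intro I g
  suffices h : ∃ b, ∀ y (hy : y ∈ I), y * b = g ⟨y, hy⟩ by
    obtain ⟨b, hb⟩ := h
    exact ⟨LinearMap.toSpanSingleton B B b, fun y hy => by simpa using hb y hy⟩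
  obtain ⟨J, ⟨hJI, b, hb⟩, hmax⟩ := set_has_maximal_iff_noetherian.mpr
    (inferInstance : IsNoetherian B B)
    {J : Ideal B | J ≤ I ∧ ∃ b, ∀ y (hy : y ∈ I), y ∈ J → y * b = g ⟨y, hy⟩}
    ⟨⊥, bot_le, 0, fun y hy hy0 => by
      obtain rfl : y = 0 := by simpa using hy0
      rw [zero_mul]
      exact (map_zero g).symm⟩
  by_cases hIJ : I ≤ J
  · exact ⟨b, fun y hy => hb y hy (hIJ hy)⟩
  exfalso
  obtain ⟨a, haI, haJ, hma⟩ := exists_mem_notMem_of_isNilpotent hnil hIJ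
  obtain ⟨c₀, hc₀, hc₀a⟩ : ∃ c, (∀ b ∈ J, c * b = 0) ∧ c * a = x := by
    have : ¬ ∀ c, (∀ b ∈ J, c * b = 0) → c * a = 0 :=
      fun h => haJ (mem_of_forall_annihilator hx hx0 J a h)
    push Not at this
    obtain ⟨c, hc, hca⟩ := this
    obtain ⟨t, ht⟩ := hx _ hca
    exact ⟨t * c, fun b hb => by rw [mul_assoc, hc b hb, mul_zero], by rw [mul_assoc, ht]⟩
  obtain ⟨u, hu⟩ : ∃ u, g ⟨a, haI⟩ - a * b = u * x := by
    by_cases hy0 : g ⟨a, haI⟩ - a * b = 0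
    · exact ⟨0, by simp [hy0]⟩
    obtain ⟨t, ht⟩ := hx _ hy0
    obtain ⟨s, hs⟩ := hunit t fun h => hx0 (by
      have h1 := hb (t * a) (I.mul_mem_left t haI)
        (hma t (by simpa [Ideal.mem_torsionOf_iff] using h))
      have h2 : g ⟨t * a, I.mul_mem_left t haI⟩ = t * g ⟨a, haI⟩ := g.map_smul t ⟨a, haI⟩
      linear_combination -ht - h1 - h2)
    exact ⟨s, by rw [← ht, ← mul_assoc, hs, one_mul]⟩
  refine hmax (J ⊔ Ideal.span {a}) ⟨sup_le hJI (by simpa [Ideal.span_le] using haI),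
    b + u * c₀, ?_⟩
    (lt_of_le_of_ne le_sup_left fun h =>
      haJ (h ▸ Ideal.mem_sup_right (Ideal.mem_span_singleton_self a)))
  intro y hy hyJ
  obtain ⟨j, hj, k, hk, rfl⟩ := Submodule.mem_sup.mp hyJ
  obtain ⟨r, rfl⟩ := Ideal.mem_span_singleton'.mp hk
  have h1 : g ⟨j + r * a, hy⟩ = g ⟨j, hJI hj⟩ + r * g ⟨a, haI⟩ := by
    rw [← smul_eq_mul r (g _), ← map_smul, ← map_add]
    rfl
  rw [h1, ← hb j (hJI hj) hj]
  linear_combination u * hc₀ j hj + r * u * hc₀a - r * hu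

end Socle

/-- Over a self-injective ring, a functional vanishing on the kernel of `f` factors through `f`. -/
theorem exists_comp_eq_of_ker_le {B F G : Type*} [CommRing B] [AddCommGroup F] [AddCommGroup G]
    [Module B F] [Module B G]
    (hB : Module.Baer B B) (f : F →ₗ[B] G) (r : F →ₗ[B] B)
    (hr : LinearMap.ker f ≤ LinearMap.ker r) :
    ∃ c : G →ₗ[B] B, c ∘ₗ f = r := by
  obtain ⟨c, hc⟩ := hB.extension_property ((LinearMap.ker f).liftQ f le_rfl)
    (LinearMap.ker_eq_bot.mp (Submodule.ker_liftQ_eq_bot _ _ _ le_rfl))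
    ((LinearMap.ker f).liftQ r hr)
  refine ⟨c, LinearMap.ext fun y => ?_⟩
  simpa using LinearMap.congr_fun hc (Submodule.Quotient.mk y)

theorem MinorsVanish.det_of_functionals {B : Type*} [CommRing B] (hB : Module.Baer B B)
    {n m s : ℕ} {M : Matrix (Fin n) (Fin m) B} (h : MinorsVanish M s) {ι κ : Type*}
    (r : ι → (Fin m → B) →ₗ[B] B) (v : κ → Fin m → B)
    (hr : ∀ i, LinearMap.ker M.mulVecLin ≤ LinearMap.ker (r i)) :
    MinorsVanish (Matrix.of fun i j => r i (v j)) s := by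
  choose c hc using fun i => exists_comp_eq_of_ker_le hB M.mulVecLin (r i) (hr i)
  have : (Matrix.of fun i j => r i (v j)) =
      (Matrix.of fun i p => c i (Pi.single p 1)) * M * (Matrix.of fun q j => v j q) := by
    ext i j
    rw [of_apply, ← hc i, LinearMap.comp_apply, LinearMap.pi_apply_eq_sum_univ (c i),
      Matrix.mul_assoc, mul_apply]
    refine Finset.sum_congr rfl fun p _ => ?_
    rw [smul_eq_mul, mul_comm]
    refine congrArg₂ _ ?_ rfl
    refine congrArg (c i) (funext fun q => ?_)
    simp [Pi.single_apply, eq_comm]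
  rw [this]
  exact (h.mul_left _).mul_right _

/-- The proof compares `M` and `M'` through the graph of the isomorphism of kernels, extended to
linear maps `Φ` and `Ψ` between the ambient free modules. -/
theorem MinorsVanish.of_ker_equiv {B : Type*} [CommRing B] (hB : Module.Baer B B)
    {n m n' m' s s' : ℕ} {M : Matrix (Fin n) (Fin m) B} {M' : Matrix (Fin n') (Fin m') B}
    (e : LinearMap.ker M.mulVecLin ≃ₗ[B] LinearMap.ker M'.mulVecLin)
    (h : MinorsVanish M' s') (hs : s' + m ≤ s + m') : MinorsVanish M s := by
  have hext : ∀ {p q : ℕ} {N : Submodule B (Fin p → B)} (φ : N →ₗ[B] (Fin q → B)),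
      ∃ Φ : (Fin p → B) →ₗ[B] (Fin q → B), ∀ y : N, Φ y = φ y := by
    intro p q N φ
    choose Φ hΦ using fun i => hB.extension_property N.subtype N.injective_subtype
      (LinearMap.proj i ∘ₗ φ)
    exact ⟨LinearMap.pi Φ, fun y => funext fun i => LinearMap.congr_fun (hΦ i) y⟩
  obtain ⟨Φ, hΦ⟩ := hext ((LinearMap.ker M'.mulVecLin).subtype ∘ₗ e.toLinearMap)
  obtain ⟨Ψ, hΨ⟩ := hext ((LinearMap.ker M.mulVecLin).subtype ∘ₗ e.symm.toLinearMap)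
  intro ri ci
  let r : Fin s → (Fin m → B) →ₗ[B] B := fun i => LinearMap.proj (ri i) ∘ₗ M.mulVecLin
  let v : Fin s → Fin m → B := fun j => Pi.single (ci j) 1
  let P : Fin s ⊕ Fin m' → (Fin m → B) →ₗ[B] B :=
    Sum.elim r fun p => -(LinearMap.proj p ∘ₗ Φ)
  let Q : Fin s ⊕ Fin m' → (Fin m' → B) →ₗ[B] B := Sum.elim 0 LinearMap.proj
  let V : Fin s ⊕ Fin m' → Fin m → B := Sum.elim v 0
  let W : Fin s ⊕ Fin m' → Fin m' → B := Sum.elim (fun j => Φ (v j)) fun q => Pi.single q 1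
  have hker : ∀ i, LinearMap.ker M'.mulVecLin ≤ LinearMap.ker (P i ∘ₗ Ψ + Q i) := by
    intro i y hy
    have h1 : Ψ y = e.symm ⟨y, hy⟩ := hΨ ⟨y, hy⟩
    have h2 : Φ (Ψ y) = y := by
      rw [h1, hΦ]
      simp
    have h3 : M.mulVecLin (Ψ y) = 0 := h1 ▸ (e.symm ⟨y, hy⟩).2
    rcases i with i | p
    · simp only [LinearMap.mem_ker, LinearMap.add_apply, LinearMap.comp_apply, P, Q, r,
        Sum.elim_inl, h3]
      simp
    · simp [P, Q, h2]
  have hvan := (h.det_of_functionals hB _ W hker).add_mul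
    (Matrix.of fun i p => P i (Pi.single p 1)) (Matrix.of fun p j => (V j - Ψ (W j)) p)
  have hblock : (Matrix.of fun i j => (P i ∘ₗ Ψ + Q i) (W j)) +
      (Matrix.of fun i p => P i (Pi.single p 1)) * (Matrix.of fun p j => (V j - Ψ (W j)) p) =
      fromBlocks (M.submatrix ri ci) 0 0 1 := by
    have hgen : ∀ i j, ((Matrix.of fun i j => (P i ∘ₗ Ψ + Q i) (W j)) +
        (Matrix.of fun i p => P i (Pi.single p 1)) *
          (Matrix.of fun p j => (V j - Ψ (W j)) p)) i j = P i (V j) + Q i (W j) := by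
      intro i j
      have : P i (V j - Ψ (W j)) =
          ∑ p, P i (Pi.single p 1) * (V j - Ψ (W j)) p := by
        rw [LinearMap.pi_apply_eq_sum_univ (P i)]
        refine Finset.sum_congr rfl fun p _ => ?_
        rw [smul_eq_mul, mul_comm]
        congr 2
        ext q
        simp [Pi.single_apply, eq_comm]
      rw [Matrix.add_apply, mul_apply]
      simp only [of_apply]
      rw [← this, map_sub, LinearMap.add_apply, LinearMap.comp_apply]
      ring
    ext i j
    rw [hgen]
    rcases i with i | i <;> rcases j with j | j
    · simp [P, Q, V, r, v]
    · simp [P, Q, V]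
    · simp [P, Q, V, W]
    · simp [P, Q, V, W, Matrix.one_apply, Pi.single_apply]
  rw [hblock] at hvan
  simpa using hvan.det_eq_zero (by simpa using hs)

theorem minorsIdeal_le_iff {A : Type*} [CommRing A] {n m : ℕ} (M : Matrix (Fin n) (Fin m) A)
    (s : ℕ) (J : Ideal A) :
    minorsIdeal M s ≤ J ↔ MinorsVanish (M.map (Ideal.Quotient.mk J)) s := by
  have hdet : ∀ (ri : Fin s → Fin n) (ci : Fin s → Fin m),
      ((M.map (Ideal.Quotient.mk J)).submatrix ri ci).det =
        Ideal.Quotient.mk J (M.submatrix ri ci).det := fun ri ci => by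
    rw [RingHom.map_det]
    rfl
  constructor
  · intro h ri ci
    by_cases hri : Function.Injective ri
    · by_cases hci : Function.Injective ci
      · rw [hdet, Ideal.Quotient.eq_zero_iff_mem]
        exact h (Ideal.subset_span ⟨ri, ci, hri, hci, rfl⟩)
      · obtain ⟨a, b, hab, hne⟩ := Function.not_injective_iff.mp hci
        exact det_zero_of_column_eq hne fun i => by simp [hab]
    · obtain ⟨a, b, hab, hne⟩ := Function.not_injective_iff.mp hri
      exact det_zero_of_row_eq hne (by ext i; simp [hab])
  · intro h
    refine Ideal.span_le.mpr ?_
    rintro _ ⟨ri, ci, -, -, rfl⟩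
    exact Ideal.Quotient.eq_zero_iff_mem.mp ((hdet ri ci).symm.trans (h ri ci))

theorem minorsIdeal_le_of_ker_equiv {A : Type*} [CommRing A] [IsNoetherianRing A]
    {n m n' m' s s' : ℕ} (M : Matrix (Fin n) (Fin m) A) (M' : Matrix (Fin n') (Fin m') A)
    (hker : ∀ I : Ideal A,
      Nonempty (↥(LinearMap.ker (M.map (Ideal.Quotient.mk I)).mulVecLin) ≃ₗ[A ⧸ I]
        ↥(LinearMap.ker (M'.map (Ideal.Quotient.mk I)).mulVecLin)))
    (hs : s' + m ≤ s + m') : minorsIdeal M s ≤ minorsIdeal M' s' := by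
  intro x hxM
  by_contra hxM'
  obtain ⟨J, ⟨hJ, hxJ⟩, hmax⟩ := set_has_maximal_iff_noetherian.mpr
    (inferInstance : IsNoetherian A A) {J : Ideal A | minorsIdeal M' s' ≤ J ∧ x ∉ J}
    ⟨_, le_rfl, hxM'⟩
  have hx0 : Ideal.Quotient.mk J x ≠ 0 := fun h => hxJ (Ideal.Quotient.eq_zero_iff_mem.mp h)
  have hx : ∀ y : A ⧸ J, y ≠ 0 → ∃ t, t * y = Ideal.Quotient.mk J x := by
    intro y hy
    obtain ⟨y, rfl⟩ := Ideal.Quotient.mk_surjective y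
    have hyJ : y ∉ J := fun h => hy (Ideal.Quotient.eq_zero_iff_mem.mpr h)
    have hmem : x ∈ J ⊔ Ideal.span {y} := by
      by_contra hcon
      exact hmax _ ⟨hJ.trans le_sup_left, hcon⟩ (lt_of_le_of_ne le_sup_left fun h =>
        hyJ (h ▸ Ideal.mem_sup_right (Ideal.mem_span_singleton_self y)))
    obtain ⟨j, hj, k, hk, rfl⟩ := Submodule.mem_sup.mp hmem
    obtain ⟨r, rfl⟩ := Ideal.mem_span_singleton'.mp hk
    exact ⟨Ideal.Quotient.mk J r, by simp [Ideal.Quotient.eq_zero_iff_mem.mpr hj]⟩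
  obtain ⟨e⟩ := hker J
  exact hxJ ((minorsIdeal_le_iff M s J).mpr (MinorsVanish.of_ker_equiv
    (baer_of_forall_exists_mul_eq hx hx0) e ((minorsIdeal_le_iff M' s' J).mp hJ) hs) hxM)

theorem minorsIdeal_zero {A : Type*} [CommRing A] {n m : ℕ} (M : Matrix (Fin n) (Fin m) A) :
    minorsIdeal M 0 = ⊤ :=
  (Ideal.eq_top_iff_one _).mpr (Ideal.subset_span
    ⟨Fin.elim0, Fin.elim0, fun a => a.elim0, fun a => a.elim0, det_fin_zero.symm⟩)

/-- Lemma `detl-invariance`: if two maps of finite free modules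
over a Noetherian ring `A` have isomorphic kernels after base change to `A/I` for
every ideal `I`, then for each `k ≥ 0` their `k`-th vanishing ideals (generated by
minors of sizes `m+1-k` and `m'+1-k` respectively) coincide. -/
theorem stmt_7 (A : Type*) [CommRing A] [IsNoetherianRing A]
    {n m n' m' : ℕ} (M : Matrix (Fin n) (Fin m) A) (M' : Matrix (Fin n') (Fin m') A)
    (hker : ∀ I : Ideal A,
      Nonempty (↥(LinearMap.ker (M.map (Ideal.Quotient.mk I)).mulVecLin) ≃ₗ[A ⧸ I]
        ↥(LinearMap.ker (M'.map (Ideal.Quotient.mk I)).mulVecLin)))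
    (k : ℕ) :
    minorsIdeal M (m + 1 - k) = minorsIdeal M' (m' + 1 - k) := by
  have hle : ∀ {p q p' q' : ℕ} (N : Matrix (Fin p) (Fin q) A) (N' : Matrix (Fin p') (Fin q') A),
      (∀ I : Ideal A,
        Nonempty (↥(LinearMap.ker (N.map (Ideal.Quotient.mk I)).mulVecLin) ≃ₗ[A ⧸ I]
          ↥(LinearMap.ker (N'.map (Ideal.Quotient.mk I)).mulVecLin))) →
      minorsIdeal N (q + 1 - k) ≤ minorsIdeal N' (q' + 1 - k) := by
    intro p q p' q' N N' h
    rcases le_or_gt k q' with hk | hk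
    · exact minorsIdeal_le_of_ker_equiv N N' h (by omega)
    · rw [show q' + 1 - k = 0 by omega, minorsIdeal_zero]
      exact le_top
  exact le_antisymm (hle M M' hker) (hle M' M fun I => (hker I).map LinearEquiv.symm)
end

section
/- Let $A$ be a commutative ring, $f: E \to F$ and $f': E' \to F'$ maps of finite free $A$-modules of ranks $\mathrm{rk}\,E = m$, $\mathrm{rk}\,E' = m'$, and let $g: E \to E'$, $h: F \to F'$ be $A$-linear maps with $f' \circ g = h \circ f$. Suppose that for every maximal ideal $\mathfrak{m}$ of $A$, the induced map $g \otimes A/\mathfrak{m}$ is injective on the kernel of $f \otimes A/\mathfrak{m}$. Then for every $k \geq 0$, the ideal of $(m'+1-k)\times(m'+1-k)$ minors of $f'$ is contained in the ideal of $(m+1-k)\times(m+1-k)$ minors of $f$. Equivalently, the $k$-th vanishing locus $V_k(f)$ is a closed subscheme of $V_k(f')$. -/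
theorem Matrix.det_submatrix_mem_minorsIdeal {A : Type*} [CommRing A] {n m : ℕ}
    (M : Matrix (Fin n) (Fin m) A) {s : ℕ} (ri : Fin s → Fin n) (ci : Fin s → Fin m) :
    (M.submatrix ri ci).det ∈ minorsIdeal M s := by
  by_cases hr : Function.Injective ri
  · by_cases hc : Function.Injective ci
    · exact Ideal.subset_span ⟨ri, ci, hr, hc, rfl⟩
    · obtain ⟨i, j, hij, hne⟩ : ∃ i j, ci i = ci j ∧ i ≠ j := by
        simpa [Function.Injective] using hc
      rw [det_zero_of_column_eq hne (by simp [hij])]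
      exact zero_mem _
  · obtain ⟨i, j, hij, hne⟩ : ∃ i j, ri i = ri j ∧ i ≠ j := by
      simpa [Function.Injective] using hr
    rw [det_zero_of_row_eq hne (by ext; simp [hij])]
    exact zero_mem _

/-- If the `r × r` minors of a matrix lie in an ideal, so do all larger minors. -/
theorem Matrix.det_submatrix_mem_of_le {A α β : Type*} [CommRing A] (I : Ideal A)
    (N : Matrix α β A) {r : ℕ}
    (hN : ∀ (f : Fin r → α) (g : Fin r → β), (N.submatrix f g).det ∈ I)
    {t : ℕ} (hrt : r ≤ t) (f : Fin t → α) (g : Fin t → β) : (N.submatrix f g).det ∈ I := by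
  induction t, hrt using Nat.le_induction with
  | base => exact hN f g
  | succ t _ ih =>
    rw [det_succ_row_zero]
    exact Ideal.sum_mem _ fun j _ => Ideal.mul_mem_left _ _ (ih _ _)

/-- Appending `c` rows to a matrix whose `r × r` minors lie in an ideal gives a matrix whose
minors of size at least `r + c` lie in that ideal. -/
theorem Matrix.det_submatrix_fromRows_mem {A α α' β : Type*} [CommRing A] (I : Ideal A)
    (N : Matrix α β A) (V : Matrix α' β A) {r : ℕ}
    (hN : ∀ (f : Fin r → α) (g : Fin r → β), (N.submatrix f g).det ∈ I)
    (c : ℕ) {t : ℕ} (f : Fin t → α ⊕ α') (g : Fin t → β)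
    (hc : (Finset.univ.filter fun i => (f i).isRight).card ≤ c) (hrt : r + c ≤ t) :
    ((fromRows N V).submatrix f g).det ∈ I := by
  induction c generalizing t with
  | zero =>
    have hl : ∀ i, ∃ a, f i = Sum.inl a := by
      intro i
      have hi : (f i).isRight = false := by simpa using
        (Finset.filter_eq_empty_iff.mp (Finset.card_eq_zero.mp (Nat.le_zero.mp hc))
          (Finset.mem_univ i))
      exact Sum.isLeft_iff.mp (by simpa using hi)
    choose f' hf' using hl
    have : (fromRows N V).submatrix f g = N.submatrix f' g := by
      ext i j
      simp [hf']
    rw [this]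
    exact det_submatrix_mem_of_le I N hN hrt f' g
  | succ c ih =>
    by_cases h : ∃ i, (f i).isRight
    · obtain ⟨i, hi⟩ := h
      obtain ⟨t, rfl⟩ : ∃ u, t = u + 1 := ⟨t - 1, by omega⟩
      rw [det_succ_row _ i]
      refine Ideal.sum_mem _ fun j _ => Ideal.mul_mem_left _ _ ?_
      rw [submatrix_submatrix]
      refine ih _ _ ?_ (by omega)
      have hlt : ((Finset.univ.filter fun k => (f (i.succAbove k)).isRight).map
          i.succAboveEmb).card <
          (Finset.univ.filter fun k => (f k).isRight).card := by
        refine Finset.card_lt_card (Finset.ssubset_iff.mpr ⟨i, ?_, ?_⟩)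
        · simp
        · intro k
          simp only [Finset.mem_insert, Finset.mem_map, Finset.mem_filter, Finset.mem_univ,
            true_and]
          rintro (rfl | ⟨l, hl, rfl⟩)
          · exact hi
          · exact hl
      rw [Finset.card_map] at hlt
      simp only [Function.comp_apply]
      omega
    · push Not at h
      refine ih f g ?_ (by omega)
      rw [Finset.filter_false_of_mem fun i _ => h i]
      simp

/-- The determinant of a product lies in any ideal containing the maximal minors
of the right factor. -/
theorem Matrix.det_mul_mem {A ι α : Type*} [CommRing A] [Fintype ι] [DecidableEq ι] [Fintype α]
    (I : Ideal A) (X : Matrix ι α A) (N : Matrix α ι A)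
    (hN : ∀ f : ι → α, Function.Injective f → (N.submatrix f id).det ∈ I) :
    (X * N).det ∈ I := by
  classical
  have hrow : X * N = fun i => ∑ a, X i a • N a := by
    ext i j
    simp [mul_apply, Finset.sum_apply]
  have hdet : (X * N).det = ∑ f : ι → α, (∏ i, X i (f i)) * (N.submatrix f id).det := by
    rw [hrow]
    change (detRowAlternating (R := A) (n := ι)).toMultilinearMap _ = _
    rw [MultilinearMap.map_sum]
    refine Finset.sum_congr rfl fun f _ => ?_
    rw [MultilinearMap.map_smul_univ]
    rfl
  rw [hdet]
  refine Ideal.sum_mem _ fun f _ => Ideal.mul_mem_left _ _ ?_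
  by_cases hf : Function.Injective f
  · exact hN f hf
  · obtain ⟨i, j, hij, hne⟩ : ∃ i j, f i = f j ∧ i ≠ j := by
      simpa [Function.Injective] using hf
    rw [det_zero_of_row_eq hne (by ext; simp [hij])]
    exact zero_mem _

theorem Matrix.det_submatrix_fromCols_zero_mem {A : Type*} [CommRing A] {n m r : ℕ} {γ : Type*}
    (M : Matrix (Fin n) (Fin m) A) (f : Fin r → Fin n) (g : Fin r → Fin m ⊕ γ) :
    ((fromCols M (0 : Matrix (Fin n) γ A)).submatrix f g).det ∈ minorsIdeal M r := by
  by_cases h : ∃ j c, g j = Sum.inr c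
  · obtain ⟨j, c, hj⟩ := h
    rw [det_eq_zero_of_column_eq_zero j (by simp [hj])]
    exact zero_mem _
  · have hl : ∀ j, ∃ a, g j = Sum.inl a := fun j => by
      rcases hj : g j with a | c
      · exact ⟨a, rfl⟩
      · exact (h ⟨j, c, hj⟩).elim
    choose g' hg' using hl
    have : (fromCols M (0 : Matrix (Fin n) γ A)).submatrix f g = M.submatrix f g' := by
      ext i j
      simp [hg']
    rw [this]
    exact det_submatrix_mem_minorsIdeal M f g'

/-- A pair of matrices with no common kernel modulo a maximal ideal has a left inverse up to an
element outside that ideal. -/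
theorem Matrix.exists_det_mul_add_mul_notMem {A : Type*} [CommRing A]
    {μ ν ν' : Type*} [Fintype μ] [DecidableEq μ] [Fintype ν] [Fintype ν']
    (M : Matrix ν μ A) (G : Matrix ν' μ A) (I : Ideal A) [hI : I.IsMaximal]
    (hinj : ∀ x : μ → A ⧸ I, (M.map (Ideal.Quotient.mk I)).mulVec x = 0 →
      (G.map (Ideal.Quotient.mk I)).mulVec x = 0 → x = 0) :
    ∃ (P : Matrix μ ν A) (Q : Matrix μ ν' A), (P * M + Q * G).det ∉ I := by
  classical
  let : Field (A ⧸ I) := Ideal.Quotient.field I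
  set π := Ideal.Quotient.mk I
  have hker : LinearMap.ker (toLin' (fromRows (M.map π) (G.map π))) = ⊥ := by
    refine LinearMap.ker_eq_bot'.mpr fun x hx => ?_
    rw [toLin'_apply, fromRows_mulVec] at hx
    exact hinj x (funext fun i => congrFun hx (Sum.inl i))
      (funext fun i => congrFun hx (Sum.inr i))
  obtain ⟨L, hL⟩ := LinearMap.exists_leftInverse_of_injective _ hker
  have hL' : LinearMap.toMatrix' L * fromRows (M.map π) (G.map π) = 1 := by
    rw [← LinearMap.toMatrix'_toLin' (fromRows (M.map π) (G.map π)), ← LinearMap.toMatrix'_comp, hL,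
      LinearMap.toMatrix'_id]
  have hπ : Function.Surjective π := Ideal.Quotient.mk_surjective
  choose σ hσ using hπ
  let T := (LinearMap.toMatrix' L).map σ
  have hT : T.map π = LinearMap.toMatrix' L := by
    ext i j
    simp [T, hσ]
  refine ⟨T.toCols₁, T.toCols₂, fun hmem => ?_⟩
  rw [← fromCols_mul_fromRows, fromCols_toCols] at hmem
  rw [← Ideal.Quotient.eq_zero_iff_mem, RingHom.map_det, RingHom.mapMatrix_apply, Matrix.map_mul]
    at hmem
  have hmap : (fromRows M G).map π = fromRows (M.map π) (G.map π) := by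
    ext (i | i) j <;> rfl
  change (T.map π * (fromRows M G).map π).det = 0 at hmem
  rw [hT, hmap, hL', det_one] at hmem
  exact one_ne_zero hmem

open Matrix in
theorem det_mul_det_submatrix_mem_minorsIdeal {A : Type*} [CommRing A] {n m n' m' : ℕ}
    (M : Matrix (Fin n) (Fin m) A) (M' : Matrix (Fin n') (Fin m') A)
    (G : Matrix (Fin m') (Fin m) A) (H : Matrix (Fin n') (Fin n) A) (hcomm : M' * G = H * M)
    (P : Matrix (Fin m) (Fin n) A) (Q : Matrix (Fin m) (Fin m') A) {s r : ℕ}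
    (hr : r + m' ≤ m + s) (ρ : Fin s → Fin n') (γ : Fin s → Fin m') :
    (P * M + Q * G).det * (M'.submatrix ρ γ).det ∈ minorsIdeal M r := by
  have hprod : fromBlocks P Q (-H.submatrix ρ id) (M'.submatrix ρ id) *
      fromRows (fromCols M (0 : Matrix (Fin n) (Fin s) A))
        (fromCols G ((1 : Matrix (Fin m') (Fin m') A).submatrix id γ)) =
      fromBlocks (P * M + Q * G) (Q.submatrix id γ) 0 (M'.submatrix ρ γ) := by
    have hH : H.submatrix ρ id * M = (H * M).submatrix ρ id := by
      ext; simp [mul_apply]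
    have hM' : M'.submatrix ρ id * G = (M' * G).submatrix ρ id := by
      ext; simp [mul_apply]
    have h1 : Q * (1 : Matrix (Fin m') (Fin m') A).submatrix id γ = Q.submatrix id γ := by
      ext; simp [mul_apply, one_apply]
    have h2 : M'.submatrix ρ id * (1 : Matrix (Fin m') (Fin m') A).submatrix id γ =
        M'.submatrix ρ γ := by
      ext; simp [mul_apply, one_apply]
    rw [fromRows_fromCols_eq_fromBlocks, fromBlocks_multiply, h1, h2, Matrix.neg_mul, hH, hM', hcomm]
    simp
  rw [← det_fromBlocks_zero₂₁ (P * M + Q * G) (Q.submatrix id γ), ← hprod]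
  refine det_mul_mem _ _ _ fun f hf => ?_
  rw [← det_submatrix_equiv_self finSumFinEquiv.symm, submatrix_submatrix]
  refine det_submatrix_fromRows_mem _ _ _ (det_submatrix_fromCols_zero_mem M) m' _ _ ?_ hr
  have hinj : Function.Injective (f ∘ finSumFinEquiv.symm) :=
    hf.comp finSumFinEquiv.symm.injective
  calc _ ≤ ((Finset.univ : Finset (Fin m')).map
        (Function.Embedding.inr : Fin m' ↪ Fin n ⊕ Fin m')).card := by
        refine Finset.card_le_card_of_injOn (f ∘ finSumFinEquiv.symm) (fun i hi => ?_)
          hinj.injOn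
        obtain ⟨a, ha⟩ := Sum.isRight_iff.mp (Finset.mem_filter.mp hi).2
        simp only [Finset.coe_map, Set.mem_image]
        exact ⟨a, by simp, ha.symm⟩
    _ = m' := by simp

/-- Proposition `detl-inclusion`: given a morphism of two-term
complexes `(g,h) : (f : E → F) → (f' : E' → F')` of finite free `A`-modules such
that at every maximal ideal the induced map `g` is injective on the kernel of `f`
fiberwise, the `k`-th vanishing locus of `f` is a closed subscheme of that of
`f'`, i.e. the ideal of `(m'+1-k)`-minors of `f'` is contained in the ideal of
`(m+1-k)`-minors of `f`. -/
theorem stmt_8 (A : Type*) [CommRing A] {n m n' m' : ℕ}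
    (M : Matrix (Fin n) (Fin m) A) (M' : Matrix (Fin n') (Fin m') A)
    (Gm : Matrix (Fin m') (Fin m) A) (Hm : Matrix (Fin n') (Fin n) A)
    (hcomm : M' * Gm = Hm * M)
    (hinj : ∀ I : Ideal A, I.IsMaximal → ∀ x : Fin m → A ⧸ I,
      (M.map (Ideal.Quotient.mk I)).mulVec x = 0 →
      (Gm.map (Ideal.Quotient.mk I)).mulVec x = 0 → x = 0)
    (k : ℕ) :
    minorsIdeal M' (m' + 1 - k) ≤ minorsIdeal M (m + 1 - k) := by
  refine Ideal.span_le.mpr ?_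
  rintro _ ⟨ρ, γ, -, -, rfl⟩
  set x := (M'.submatrix ρ γ).det
  rcases Nat.eq_zero_or_pos (m + 1 - k) with h0 | hpos
  · rw [h0]
    have h1 := M.det_submatrix_mem_minorsIdeal (s := 0) Fin.elim0 Fin.elim0
    rw [Matrix.det_fin_zero] at h1
    rw [(Ideal.eq_top_iff_one _).mpr h1]
    exact Submodule.mem_top
  · by_contra hx
    have hcolon : (minorsIdeal M (m + 1 - k)).colon {x} ≠ ⊤ := fun htop => hx <| by
      have h1 := Submodule.mem_colon_singleton.mp ((Ideal.eq_top_iff_one _).mp htop)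
      simpa using h1
    obtain ⟨I, hI, hle⟩ := Ideal.exists_le_maximal _ hcolon
    obtain ⟨P, Q, hPQ⟩ := Matrix.exists_det_mul_add_mul_notMem M Gm I (hinj I hI)
    exact hPQ <| hle <| Submodule.mem_colon_singleton.mpr <|
      det_mul_det_submatrix_mem_minorsIdeal M M' Gm Hm hcomm P Q (by omega) ρ γ
end
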